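/- arXiv:2604.04686 — 2 statements merged into one kernel-verified Lean document; each statement's English description precedes it below -/
import Mathlib

section
/- Define J : ℝ → ℝ by J θ = ∑_τ P θ τ * ∑_{t : Fin T} r (σ_τ t) (α_τ t), and the reward-to-go R j τ = ∑_{t : Fin T, j ≤ t} r (σ_τ t) (α_τ t). Then J is differentiable and for every θ, deriv J θ = ∑_{j : Fin T} ∑_τ P θ τ * score θ j τ * R j τ; that is, the policy gradient equals the sum over time steps of the expectation of the policy score at time j multiplied by the reward-to-go from time j (the reward-to-go form of the policy gradient). -/
open scoped BigOperators

/-- The probability of a full trajectory `τ = (σ, α)` in a finite-horizon MDP: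
`P θ τ = init (σ 0) * ∏ i π θ (σ i) (α i) * ∏_{i+1 < T} trans (σ i) (α i) (σ (i+1))`. -/
noncomputable def Ptraj {S A : Type} [Fintype S] [Fintype A] {T : ℕ} (hT : 1 ≤ T)
    (init : S → ℝ) (trans : S → A → S → ℝ) (π : ℝ → S → A → ℝ)
    (θ : ℝ) (τ : (Fin T → S) × (Fin T → A)) : ℝ :=
  init (τ.1 ⟨0, hT⟩) * (∏ i : Fin T, π θ (τ.1 i) (τ.2 i)) *
    ∏ i : Fin T,
      if h : (i : ℕ) + 1 < T then trans (τ.1 i) (τ.2 i) (τ.1 ⟨(i : ℕ) + 1, h⟩) else 1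

/-- The policy score at time `j` along trajectory `τ`. -/
noncomputable def score {S A : Type} {T : ℕ} (π : ℝ → S → A → ℝ)
    (θ : ℝ) (j : Fin T) (τ : (Fin T → S) × (Fin T → A)) : ℝ :=
  deriv (fun u => Real.log (π u (τ.1 j) (τ.2 j))) θ

/-- The performance objective: expected total return. -/
noncomputable def Jobj {S A : Type} [Fintype S] [Fintype A] {T : ℕ} (hT : 1 ≤ T)
    (init : S → ℝ) (trans : S → A → S → ℝ) (π : ℝ → S → A → ℝ)
    (r : S → A → ℝ) (θ : ℝ) : ℝ :=
  ∑ τ : (Fin T → S) × (Fin T → A),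
    Ptraj hT init trans π θ τ * ∑ t : Fin T, r (τ.1 t) (τ.2 t)

/-- The reward-to-go from time `j` along trajectory `τ`. -/
def rewardToGo {S A : Type} [Fintype S] [Fintype A] {T : ℕ}
    (r : S → A → ℝ) (j : Fin T) (τ : (Fin T → S) × (Fin T → A)) : ℝ :=
  ∑ t ∈ Finset.univ.filter (fun t : Fin T => j ≤ t), r (τ.1 t) (τ.2 t)

/-- The weight of a trajectory when the action weights `f i s a` may depend on the time `i` and
need not be normalized. -/
noncomputable def trajWeight {S A : Type} {n : ℕ} (init : S → ℝ) (trans : S → A → S → ℝ)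
    (f : Fin (n + 1) → S → A → ℝ) (σ : Fin (n + 1) → S) (α : Fin (n + 1) → A) : ℝ :=
  init (σ 0) * (∏ i, f i (σ i) (α i)) *
    ∏ i : Fin (n + 1),
      if h : (i : ℕ) + 1 < n + 1 then trans (σ i) (α i) (σ ⟨(i : ℕ) + 1, h⟩) else 1

theorem sum_fin_succ_fun {X : Type} [Fintype X] {n : ℕ} (F : (Fin (n + 1) → X) → ℝ) :
    ∑ x, F x = ∑ x₀, ∑ x' : Fin n → X, F (Fin.cons x₀ x') := by
  rw [← (Fin.consEquiv fun _ => X).sum_comp, Fintype.sum_prod_type]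
  rfl

theorem sum_trajWeight_zero {S A : Type} [Fintype S] [Fintype A] (init : S → ℝ)
    (trans : S → A → S → ℝ) (f : Fin 1 → S → A → ℝ) :
    ∑ σ, ∑ α, trajWeight init trans f σ α = ∑ s, init s * ∑ a, f 0 s a := by
  simp [sum_fin_succ_fun, trajWeight, Finset.mul_sum]

theorem trajWeight_cons {S A : Type} {n : ℕ} (init : S → ℝ) (trans : S → A → S → ℝ)
    (f : Fin (n + 2) → S → A → ℝ) (s : S) (σ : Fin (n + 1) → S) (a : A)
    (α : Fin (n + 1) → A) :
    trajWeight init trans f (Fin.cons s σ) (Fin.cons a α) =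
      trajWeight (fun s' => init s * f 0 s a * trans s a s') trans (fun i => f i.succ) σ α := by
  unfold trajWeight
  rw [Fin.prod_univ_succ, Fin.prod_univ_succ (n := n + 1)]
  have h : ∀ i : Fin (n + 1),
      (if h : ((i.succ : Fin (n + 2)) : ℕ) + 1 < n + 2 then
        trans ((Fin.cons s σ : Fin (n + 2) → S) i.succ) ((Fin.cons a α : Fin (n + 2) → A) i.succ)
          ((Fin.cons s σ : Fin (n + 2) → S) ⟨(i.succ : ℕ) + 1, h⟩) else 1) =
      if h : (i : ℕ) + 1 < n + 1 then trans (σ i) (α i) (σ ⟨(i : ℕ) + 1, h⟩) else 1 := by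
    intro i
    by_cases hi : (i : ℕ) + 1 < n + 1
    · rw [dif_pos hi, dif_pos (by simpa using hi)]
      rfl
    · rw [dif_neg hi, dif_neg (by simpa using hi)]
  simp only [h]
  rw [dif_pos (by simp)]
  have h₁ : (Fin.cons s σ : Fin (n + 2) → S) ⟨((0 : Fin (n + 2)) : ℕ) + 1, by simp⟩ = σ 0 := rfl
  simp only [h₁, Fin.cons_zero, Fin.cons_succ]
  ring

theorem trajWeight_sum_init {ι S A : Type} [Fintype ι] {n : ℕ} (init : ι → S → ℝ)
    (trans : S → A → S → ℝ) (f : Fin (n + 1) → S → A → ℝ) (σ : Fin (n + 1) → S)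
    (α : Fin (n + 1) → A) :
    trajWeight (fun s => ∑ k, init k s) trans f σ α = ∑ k, trajWeight (init k) trans f σ α := by
  simp only [trajWeight, Finset.sum_mul]

theorem sum_trajWeight_succ {S A : Type} [Fintype S] [Fintype A] {n : ℕ} (init : S → ℝ)
    (trans : S → A → S → ℝ) (f : Fin (n + 2) → S → A → ℝ) :
    ∑ σ, ∑ α, trajWeight init trans f σ α =
      ∑ σ, ∑ α, trajWeight (fun s' => ∑ s, ∑ a, init s * f 0 s a * trans s a s') trans
        (fun i => f i.succ) σ α := by
  simp only [trajWeight_sum_init]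
  rw [sum_fin_succ_fun]
  simp only [sum_fin_succ_fun (X := A) (n := n + 1), trajWeight_cons]
  rw [Finset.sum_comm]
  refine Finset.sum_congr rfl fun σ _ => ?_
  rw [Finset.sum_comm (s := (Finset.univ : Finset (Fin (n + 1) → A)))]
  exact Finset.sum_congr rfl fun s _ => Finset.sum_comm

theorem sum_init_step {S A : Type} [Fintype S] [Fintype A] (init : S → ℝ)
    (trans : S → A → S → ℝ) (htrans_sum : ∀ s a, ∑ s', trans s a s' = 1) (g : S → A → ℝ) :
    ∑ s', ∑ s, ∑ a, init s * g s a * trans s a s' = ∑ s, init s * ∑ a, g s a := by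
  rw [Finset.sum_comm]
  refine Finset.sum_congr rfl fun s _ => ?_
  rw [Finset.sum_comm, Finset.mul_sum]
  refine Finset.sum_congr rfl fun a _ => ?_
  rw [← Finset.mul_sum, htrans_sum, mul_one]

theorem sum_trajWeight_of_normalized {S A : Type} [Fintype S] [Fintype A]
    (trans : S → A → S → ℝ) (htrans_sum : ∀ s a, ∑ s', trans s a s' = 1) {n : ℕ}
    (init : S → ℝ) (f : Fin (n + 1) → S → A → ℝ) (hf : ∀ i s, ∑ a, f i s a = 1) :
    ∑ σ, ∑ α, trajWeight init trans f σ α = ∑ s, init s := by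
  induction n generalizing init with
  | zero => simp [sum_trajWeight_zero, hf]
  | succ n ih =>
    rw [sum_trajWeight_succ, ih _ _ fun i => hf i.succ, sum_init_step _ _ htrans_sum]
    simp [hf]

theorem sum_trajWeight_eq_zero {S A : Type} [Fintype S] [Fintype A]
    (trans : S → A → S → ℝ) (htrans_sum : ∀ s a, ∑ s', trans s a s' = 1) {n : ℕ}
    (init : S → ℝ) (f : Fin (n + 1) → S → A → ℝ) (j : Fin (n + 1))
    (hj : ∀ s, ∑ a, f j s a = 0) (hf : ∀ i, j < i → ∀ s, ∑ a, f i s a = 1) :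
    ∑ σ, ∑ α, trajWeight init trans f σ α = 0 := by
  induction n generalizing init with
  | zero =>
    obtain rfl : j = 0 := Fin.fin_one_eq_zero j
    simp [sum_trajWeight_zero, hj]
  | succ n ih =>
    rw [sum_trajWeight_succ]
    induction j using Fin.cases with
    | zero =>
      rw [sum_trajWeight_of_normalized _ htrans_sum _ _ fun i => hf _ i.succ_pos,
        sum_init_step _ _ htrans_sum]
      simp [hj]
    | succ j =>
      exact ih _ _ j hj fun i hi => hf _ (Fin.succ_lt_succ_iff.mpr hi)

theorem score_eq {S A : Type} {T : ℕ} (π : ℝ → S → A → ℝ) (hπ_pos : ∀ θ s a, 0 < π θ s a)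
    (hπ_diff : ∀ s a, Differentiable ℝ (fun θ => π θ s a)) (θ : ℝ) (j : Fin T)
    (τ : (Fin T → S) × (Fin T → A)) :
    score π θ j τ =
      deriv (fun u => π u (τ.1 j) (τ.2 j)) θ / π θ (τ.1 j) (τ.2 j) :=
  deriv.log (hπ_diff _ _ θ) (hπ_pos _ _ _).ne'

theorem hasDerivAt_Ptraj {S A : Type} [Fintype S] [Fintype A] {T : ℕ} (hT : 1 ≤ T)
    (init : S → ℝ) (trans : S → A → S → ℝ) (π : ℝ → S → A → ℝ)
    (hπ_pos : ∀ θ s a, 0 < π θ s a)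
    (hπ_diff : ∀ s a, Differentiable ℝ (fun θ => π θ s a)) (θ : ℝ)
    (τ : (Fin T → S) × (Fin T → A)) :
    HasDerivAt (fun u => Ptraj hT init trans π u τ)
      (Ptraj hT init trans π θ τ * ∑ j, score π θ j τ) θ := by
  have h := HasDerivAt.fun_finsetProd (u := Finset.univ)
    fun (i : Fin T) _ => (hπ_diff (τ.1 i) (τ.2 i) θ).hasDerivAt
  have h' : ∑ i : Fin T, (∏ k ∈ Finset.univ.erase i, π θ (τ.1 k) (τ.2 k)) •
      deriv (fun u => π u (τ.1 i) (τ.2 i)) θ =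
      (∏ k, π θ (τ.1 k) (τ.2 k)) * ∑ j, score π θ j τ := by
    rw [Finset.mul_sum]
    refine Finset.sum_congr rfl fun i _ => ?_
    rw [score_eq π hπ_pos hπ_diff, ← Finset.prod_erase_mul _ _ (Finset.mem_univ i), smul_eq_mul]
    field_simp [(hπ_pos θ (τ.1 i) (τ.2 i)).ne']
  rw [h'] at h
  refine ((h.const_mul (init (τ.1 ⟨0, hT⟩))).mul_const _).congr_deriv ?_
  rw [Ptraj]
  ring

theorem sum_Ptraj_score_mul_past_reward {S A : Type} [Fintype S] [Fintype A] {T : ℕ}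
    (hT : 1 ≤ T) (init : S → ℝ) (trans : S → A → S → ℝ)
    (htrans_sum : ∀ s a, ∑ s', trans s a s' = 1) (r : S → A → ℝ) (π : ℝ → S → A → ℝ)
    (hπ_pos : ∀ θ s a, 0 < π θ s a) (hπ_sum : ∀ θ s, ∑ a, π θ s a = 1)
    (hπ_diff : ∀ s a, Differentiable ℝ (fun θ => π θ s a)) (θ : ℝ) {t j : Fin T} (htj : t < j) :
    ∑ τ : (Fin T → S) × (Fin T → A),
      Ptraj hT init trans π θ τ * score π θ j τ * r (τ.1 t) (τ.2 t) = 0 := by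
  obtain ⟨n, rfl⟩ : ∃ n, T = n + 1 := ⟨T - 1, by omega⟩
  rw [Fintype.sum_prod_type]
  rw [← sum_trajWeight_eq_zero trans htrans_sum init
    (fun i s a => π θ s a * (if i = j then deriv (fun u => Real.log (π u s a)) θ else 1) *
      if i = t then r s a else 1) j]
  · refine Finset.sum_congr rfl fun σ _ => Finset.sum_congr rfl fun α _ => ?_
    simp only [trajWeight, Finset.prod_mul_distrib, Finset.prod_ite_eq', Finset.mem_univ, if_true,
      Ptraj, score]
    change init (σ 0) * _ * _ * _ * _ = _
    ring
  · intro s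
    have hlog : ∀ a, π θ s a * deriv (fun u => Real.log (π u s a)) θ =
        deriv (fun u => π u s a) θ := fun a => by
      rw [deriv.log (hπ_diff s a θ) (hπ_pos θ s a).ne', mul_div_cancel₀ _ (hπ_pos θ s a).ne']
    simp only [if_true, htj.ne', if_false, mul_one, hlog]
    rw [← deriv_fun_sum fun a _ => hπ_diff s a θ]
    simp [hπ_sum]
  · intro i hi s
    simp [hi.ne', (htj.trans hi).ne', hπ_sum]

/-- The reward-to-go form of the policy gradient: `J` is differentiable and its
derivative equals the sum over time steps of the expectation of the policy
score at time `j` multiplied by the reward-to-go from time `j`. -/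
theorem policy_gradient_reward_to_go
    {S A : Type} [Fintype S] [Fintype A] [Nonempty S] [Nonempty A]
    {T : ℕ} (hT : 1 ≤ T)
    (init : S → ℝ) (hinit_nonneg : ∀ s, 0 ≤ init s) (hinit_sum : ∑ s, init s = 1)
    (trans : S → A → S → ℝ) (htrans_nonneg : ∀ s a s', 0 ≤ trans s a s')
    (htrans_sum : ∀ s a, ∑ s', trans s a s' = 1)
    (r : S → A → ℝ)
    (π : ℝ → S → A → ℝ)
    (hπ_pos : ∀ θ s a, 0 < π θ s a)
    (hπ_sum : ∀ θ s, ∑ a, π θ s a = 1)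
    (hπ_diff : ∀ s a, Differentiable ℝ (fun θ => π θ s a)) :
    Differentiable ℝ (Jobj hT init trans π r) ∧
      ∀ θ : ℝ,
        deriv (Jobj hT init trans π r) θ =
          ∑ j : Fin T, ∑ τ : (Fin T → S) × (Fin T → A),
            Ptraj hT init trans π θ τ * score π θ j τ * rewardToGo r j τ := by
  have hJ : ∀ θ, HasDerivAt (Jobj hT init trans π r)
      (∑ τ : (Fin T → S) × (Fin T → A), Ptraj hT init trans π θ τ * (∑ j, score π θ j τ) *
        ∑ t, r (τ.1 t) (τ.2 t)) θ := fun θ =>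
    HasDerivAt.fun_sum fun τ _ =>
      (hasDerivAt_Ptraj hT init trans π hπ_pos hπ_diff θ τ).mul_const _
  refine ⟨fun θ => (hJ θ).differentiableAt, fun θ => ?_⟩
  rw [(hJ θ).deriv]
  simp only [Finset.mul_sum _ (fun j => score π θ j _), Finset.sum_mul]
  rw [Finset.sum_comm]
  refine Finset.sum_congr rfl fun j _ => ?_
  rw [← sub_eq_zero, ← Finset.sum_sub_distrib]
  have hsplit : ∀ τ : (Fin T → S) × (Fin T → A),
      ∑ t, r (τ.1 t) (τ.2 t) - rewardToGo r j τ =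
        ∑ t ∈ Finset.univ.filter (fun t : Fin T => ¬ j ≤ t), r (τ.1 t) (τ.2 t) := fun τ => by
    rw [rewardToGo, sub_eq_iff_eq_add', Finset.sum_filter_add_sum_filter_not]
  simp only [← mul_sub, hsplit]
  simp only [Finset.mul_sum]
  rw [Finset.sum_comm]
  refine Finset.sum_eq_zero fun t ht => ?_
  exact sum_Ptraj_score_mul_past_reward hT init trans htrans_sum r π hπ_pos hπ_sum hπ_diff θ
    (not_le.mp (Finset.mem_filter.mp ht).2)
end

section
/- For every j : Fin T and every θ, ∑_τ P θ τ * score θ j τ * (∑_{t : Fin T} r (σ_τ t) (α_τ t)) = ∑_τ P θ τ * score θ j τ * (∑_{t : Fin T, j ≤ t} r (σ_τ t) (α_τ t)); that is, replacing the full return by the reward-to-go in the term paired with the policy score at time j does not change the expectation, because the contribution of each reward at a time earlier than j has zero expectation. -/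
open scoped BigOperators

/-- Resampling one coordinate of a function uniformly at random preserves sums over all functions. -/
theorem Fintype.card_mul_sum_eq_sum_sum_update {ι X : Type*} [Fintype ι] [DecidableEq ι]
    [Fintype X] (G : (ι → X) → ℝ) (i : ι) :
    (Fintype.card X : ℝ) * ∑ z, G z = ∑ z, ∑ x, G (Function.update z i x) := by
  have key : Function.Involutive
      (fun p : (ι → X) × X => (Function.update p.1 i p.2, p.1 i)) := by
    rintro ⟨z, x⟩
    simp
  have h := Equiv.sum_comp key.toPerm (fun p : (ι → X) × X => G p.1)
  rw [Fintype.sum_prod_type, Fintype.sum_prod_type] at h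
  simp only [Function.Involutive.coe_toPerm, Finset.sum_const, Finset.card_univ, nsmul_eq_mul] at h
  rw [h, Finset.mul_sum]

/-- If the weight of a path is a product of nonanticipating factors which are normalized after
time `j`, then a path functional that does not look past time `j` and whose one-step conditional
expectation at time `j` vanishes has zero expectation. -/
theorem sum_prod_mul_eq_zero_of_nonanticipating {X : Type*} [Fintype X] [Nonempty X] {T : ℕ}
    (w : Fin T → (Fin T → X) → ℝ) (f : (Fin T → X) → ℝ) (j : Fin T)
    (hw : ∀ i k, i < k → ∀ z x, w i (Function.update z k x) = w i z)
    (hw_sum : ∀ i z, j < i → ∑ x, w i (Function.update z i x) = 1)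
    (hf : ∀ k, j < k → ∀ z x, f (Function.update z k x) = f z)
    (hf_sum : ∀ z, ∑ x, w j (Function.update z j x) * f (Function.update z j x) = 0) :
    ∑ z, (∏ i, w i z) * f z = 0 := by
  have hcard : (Fintype.card X : ℝ) ≠ 0 := by exact_mod_cast Fintype.card_ne_zero
  have hsplit : ∀ (k : Fin T) z x,
      ∏ i with i.val < k.val + 1, w i (Function.update z k x) =
        w k (Function.update z k x) * ∏ i with i.val < k.val, w i z := by
    intro k z x
    have hset : (Finset.univ.filter fun i : Fin T => i.val < k.val + 1) =
        insert k (Finset.univ.filter fun i : Fin T => i.val < k.val) := by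
      ext i
      simp only [Finset.mem_filter, Finset.mem_univ, true_and, Finset.mem_insert, Fin.ext_iff]
      omega
    rw [hset, Finset.prod_insert (by simp)]
    congr 1
    refine Finset.prod_congr rfl fun i hi => hw i k ?_ z x
    simpa using hi
  have htrunc : ∀ n, j.val + 1 ≤ n → n ≤ T →
      ∑ z, (∏ i with i.val < n, w i z) * f z = 0 := by
    intro n hn
    induction n, hn using Nat.le_induction with
    | base =>
      intro _
      refine (mul_eq_zero.mp ?_).resolve_left hcard
      rw [Fintype.card_mul_sum_eq_sum_sum_update _ j]
      refine Finset.sum_eq_zero fun z _ => ?_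
      simp only [hsplit]
      rw [← mul_zero (∏ i with i.val < j.val, w i z), ← hf_sum z, Finset.mul_sum]
      exact Finset.sum_congr rfl fun x _ => by ring
    | succ n hn ih =>
      intro hnT
      refine (mul_eq_zero.mp ?_).resolve_left hcard
      let k : Fin T := ⟨n, hnT⟩
      have hjk : j < k := hn
      rw [Fintype.card_mul_sum_eq_sum_sum_update _ k, ← ih (Nat.le_of_succ_le hnT)]
      refine Finset.sum_congr rfl fun z _ => ?_
      have hs := hsplit k z
      simp only [k] at hs
      simp only [k, hs, hf k hjk]
      rw [← Finset.sum_mul, ← Finset.sum_mul, hw_sum k z hjk, one_mul]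
  have h := htrunc T j.isLt le_rfl
  simpa using h

/-- The factor contributed by time `i` to the probability of a path of state-action pairs: the
probability of reaching the state at time `i`, times the probability of the action taken there. -/
noncomputable def stepWeight {S A : Type} {T : ℕ} (init : S → ℝ) (trans : S → A → S → ℝ)
    (p : S → A → ℝ) (i : Fin T) (z : Fin T → S × A) : ℝ :=
  (if i.val = 0 then init (z i).1 else
    trans (z ⟨i - 1, by omega⟩).1 (z ⟨i - 1, by omega⟩).2 (z i).1) * p (z i).1 (z i).2

theorem Ptraj_eq_prod_stepWeight {S A : Type} [Fintype S] [Fintype A] {T : ℕ} (hT : 1 ≤ T)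
    (init : S → ℝ) (trans : S → A → S → ℝ) (π : ℝ → S → A → ℝ) (θ : ℝ) (z : Fin T → S × A) :
    Ptraj hT init trans π θ (fun i => (z i).1, fun i => (z i).2) =
      ∏ i, stepWeight init trans (π θ) i z := by
  obtain ⟨n, rfl⟩ := Nat.exists_eq_add_of_le' hT
  simp only [Ptraj, stepWeight, Finset.prod_mul_distrib]
  rw [mul_right_comm]
  congr 1
  rw [Fin.prod_univ_castSucc, Fin.prod_univ_succ (n := n)]
  simp [Fin.succ, Fin.castSucc, Fin.castAdd, Fin.castLE]

theorem stepWeight_update_of_lt {S A : Type} {T : ℕ} (init : S → ℝ) (trans : S → A → S → ℝ)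
    (p : S → A → ℝ) {i k : Fin T} (hik : i < k) (z : Fin T → S × A) (x : S × A) :
    stepWeight init trans p i (Function.update z k x) = stepWeight init trans p i z := by
  have h : (⟨i - 1, by omega⟩ : Fin T) ≠ k := by
    rw [Ne, Fin.ext_iff]
    dsimp only
    omega
  simp only [stepWeight, Function.update_of_ne hik.ne, Function.update_of_ne h]

theorem stepWeight_update_self {S A : Type} {T : ℕ} (init : S → ℝ) (trans : S → A → S → ℝ)
    (p : S → A → ℝ) {i : Fin T} (z : Fin T → S × A) (s : S) (a : A) :
    stepWeight init trans p i (Function.update z i (s, a)) =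
      (if i.val = 0 then init s else
        trans (z ⟨i - 1, by omega⟩).1 (z ⟨i - 1, by omega⟩).2 s) * p s a := by
  unfold stepWeight
  split_ifs with h0
  · simp
  · have h : (⟨i - 1, by omega⟩ : Fin T) ≠ i := by
      rw [Ne, Fin.ext_iff]
      dsimp only
      omega
    simp only [Function.update_self, Function.update_of_ne h]

theorem sum_stepWeight_update_self {S A : Type} [Fintype S] [Fintype A] {T : ℕ}
    {init : S → ℝ} {trans : S → A → S → ℝ} {p : S → A → ℝ} (hinit_sum : ∑ s, init s = 1)
    (htrans_sum : ∀ s a, ∑ s', trans s a s' = 1) (hp_sum : ∀ s, ∑ a, p s a = 1)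
    (i : Fin T) (z : Fin T → S × A) :
    ∑ x, stepWeight init trans p i (Function.update z i x) = 1 := by
  simp only [Fintype.sum_prod_type, stepWeight_update_self, ← Finset.mul_sum, hp_sum, mul_one]
  split_ifs
  · exact hinit_sum
  · exact htrans_sum _ _

/-- The score of a differentiable family of distributions on a finite type has mean zero. -/
theorem sum_mul_deriv_log_eq_zero {A : Type*} [Fintype A] {p : ℝ → A → ℝ} {θ : ℝ}
    (hp_ne : ∀ a, p θ a ≠ 0) (hp_sum : ∀ u, ∑ a, p u a = 1)
    (hp_diff : ∀ a, DifferentiableAt ℝ (fun u => p u a) θ) :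
    ∑ a, p θ a * deriv (fun u => Real.log (p u a)) θ = 0 := by
  have hlog : ∀ a, p θ a * deriv (fun u => Real.log (p u a)) θ = deriv (fun u => p u a) θ := by
    intro a
    rw [deriv.log (hp_diff a) (hp_ne a), mul_div_cancel₀ _ (hp_ne a)]
  simp only [hlog]
  rw [← deriv_fun_sum fun a _ => hp_diff a]
  simp [hp_sum]

/-- Replacing the full return by the reward-to-go in the term paired with the
policy score at time `j` does not change the expectation, because each reward
at a time earlier than `j` contributes zero in expectation. -/
theorem full_return_eq_reward_to_go_in_expectation
    {S A : Type} [Fintype S] [Fintype A] [Nonempty S] [Nonempty A]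
    {T : ℕ} (hT : 1 ≤ T)
    (init : S → ℝ) (hinit_nonneg : ∀ s, 0 ≤ init s) (hinit_sum : ∑ s, init s = 1)
    (trans : S → A → S → ℝ) (htrans_nonneg : ∀ s a s', 0 ≤ trans s a s')
    (htrans_sum : ∀ s a, ∑ s', trans s a s' = 1)
    (r : S → A → ℝ)
    (π : ℝ → S → A → ℝ)
    (hπ_pos : ∀ θ s a, 0 < π θ s a)
    (hπ_sum : ∀ θ s, ∑ a, π θ s a = 1)
    (hπ_diff : ∀ s a, Differentiable ℝ (fun θ => π θ s a))
    (j : Fin T) (θ : ℝ) :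
    ∑ τ : (Fin T → S) × (Fin T → A),
        Ptraj hT init trans π θ τ * score π θ j τ *
          (∑ t : Fin T, r (τ.1 t) (τ.2 t)) =
      ∑ τ : (Fin T → S) × (Fin T → A),
        Ptraj hT init trans π θ τ * score π θ j τ *
          (∑ t ∈ Finset.univ.filter (fun t : Fin T => j ≤ t), r (τ.1 t) (τ.2 t)) := by
  classical
  have hsplit : ∀ τ : (Fin T → S) × (Fin T → A),
      ∑ t : Fin T, r (τ.1 t) (τ.2 t) =
        ∑ t ∈ Finset.univ.filter (fun t : Fin T => j ≤ t), r (τ.1 t) (τ.2 t) +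
          ∑ t ∈ Finset.univ.filter (fun t : Fin T => ¬ j ≤ t), r (τ.1 t) (τ.2 t) :=
    fun τ => (Finset.sum_filter_add_sum_filter_not _ _ _).symm
  simp only [hsplit, mul_add, Finset.sum_add_distrib, add_eq_left]
  rw [← Equiv.sum_comp (Equiv.arrowProdEquivProdArrow (Fin T) (fun _ => S) (fun _ => A))]
  let past : (Fin T → S × A) → ℝ := fun z =>
    ∑ t ∈ Finset.univ.filter (fun t : Fin T => ¬ j ≤ t), r (z t).1 (z t).2
  let sc : S × A → ℝ := fun x => deriv (fun u => Real.log (π u x.1 x.2)) θ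
  have hpast : ∀ k, j ≤ k → ∀ z x, past (Function.update z k x) = past z := by
    intro k hk z x
    refine Finset.sum_congr rfl fun t ht => ?_
    have htk : t ≠ k := by
      rintro rfl
      exact (Finset.mem_filter.mp ht).2 hk
    rw [Function.update_of_ne htk]
  have hzero := sum_prod_mul_eq_zero_of_nonanticipating (stepWeight init trans (π θ))
    (fun z => sc (z j) * past z) j
    (fun _ _ hik z x => stepWeight_update_of_lt init trans (π θ) hik z x)
    (fun i z _ => sum_stepWeight_update_self hinit_sum htrans_sum (hπ_sum θ) i z)
    (fun k hk z x => by simp only [hpast k hk.le, Function.update_of_ne hk.ne])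
    (fun z => by
      simp only [hpast j le_rfl, Function.update_self, ← mul_assoc, ← Finset.sum_mul,
        Fintype.sum_prod_type, stepWeight_update_self]
      refine mul_eq_zero_of_left (Finset.sum_eq_zero fun s _ => ?_) _
      simp only [mul_assoc, ← Finset.mul_sum, sc]
      rw [sum_mul_deriv_log_eq_zero (p := fun u a => π u s a) (fun a => (hπ_pos θ s a).ne')
        (fun u => hπ_sum u s) (fun a => hπ_diff s a θ), mul_zero])
  rw [← hzero]
  refine Finset.sum_congr rfl fun z _ => ?_
  rw [← Ptraj_eq_prod_stepWeight hT, ← mul_assoc]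
  rfl
end
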